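/- Let 0 < α < 1 and let (x_n)_{n≥1} be a sequence in [0,1) having weak pair correlation with exponent α: for every s > 0, lim_{N→∞} (1/N^{2−α})·#{(m,n) : 1 ≤ m ≠ n ≤ N, ‖x_m − x_n‖ ≤ s/N^α} = 2s, where ‖·‖ denotes the distance to the nearest integer. Then (x_n) is uniformly distributed in [0,1). -/

import Mathlib

open Filter

/-- Distance from a real number to the nearest integer. -/
noncomputable def nint (x : ℝ) : ℝ := |x - round x|

lemma nint_le_abs (t : ℝ) : nint t ≤ |t| := by
  have := round_le t 0
  simpa [nint] using this

/-- indicator that the window of length `L` starting at `j` contains `c`. -/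
noncomputable def win (L : ℕ) (j c : ℤ) : ℝ := if j ≤ c ∧ c < j + L then 1 else 0

lemma win_sum (L : ℕ) (lo hi c : ℤ) (h1 : lo ≤ c - L + 1) (h2 : c ≤ hi) :
    ∑ j ∈ Finset.Icc lo hi, win L j c = L := by
  unfold win
  rw [Finset.sum_boole]
  have : (Finset.Icc lo hi).filter (fun j => j ≤ c ∧ c < j + L) = Finset.Ioc (c - L) c := by
    ext j; simp only [Finset.mem_filter, Finset.mem_Icc, Finset.mem_Ioc]; omega
  rw [this]; simp

lemma win_pair (L : ℕ) (lo hi c d : ℤ) :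
    ∑ j ∈ Finset.Icc lo hi, win L j c * win L j d
      ≤ ∑ l ∈ Finset.range L, if (c - d).natAbs ≤ l then (1:ℝ) else 0 := by
  have e : ∀ j, win L j c * win L j d
      = if ((j ≤ c ∧ c < j + L) ∧ (j ≤ d ∧ d < j + L)) then (1:ℝ) else 0 := by
    intro j; unfold win; split_ifs <;> simp_all
  simp_rw [e]
  rw [Finset.sum_boole, Finset.sum_boole]
  have e2 : (Finset.range L).filter (fun l => (c - d).natAbs ≤ l)
      = Finset.Ico (c - d).natAbs L := by
    ext j; simp only [Finset.mem_filter, Finset.mem_range, Finset.mem_Ico]; omega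
  rw [e2]
  have : (Finset.Icc lo hi).filter (fun j => (j ≤ c ∧ c < j + L) ∧ (j ≤ d ∧ d < j + L))
      ⊆ Finset.Ioc (max c d - L) (min c d) := by
    intro j; simp only [Finset.mem_filter, Finset.mem_Icc, Finset.mem_Ioc]; omega
  have := Finset.card_le_card this
  rw [Int.card_Ioc] at this
  rw [Nat.card_Ico]
  exact_mod_cast (by omega)

lemma core (S : Finset ℕ) (x : ℕ → ℝ) (hx : ∀ n, x n ∈ Set.Ico (0 : ℝ) 1) (η : ℝ) (hη : 0 < η)
    (L : ℕ) (hL : 1 ≤ L) (a b : ℝ) (ha : 0 ≤ a) (hab : a ≤ b) (hb : b ≤ 1) (Q N : ℝ)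
    (hN : N = S.card)
    (hQ : Q = ∑ l ∈ Finset.range L, (N + (((S ×ˢ S).filter
          (fun p => p.1 ≠ p.2 ∧ nint (x p.1 - x p.2) ≤ ((l:ℝ) + 1) * η)).card : ℝ))) :
    ((S.filter (fun n => a ≤ x n ∧ x n < b)).card : ℝ) * L
      ≤ L * N * η * ((b - a) / η + L + 1)
        + √(((b - a) / η + L + 1) * (Q - L ^ 2 * N ^ 2 * η + L ^ 2 * N ^ 2 * η ^ 2 * L)) := by
  set c : ℕ → ℤ := fun n => ⌊x n / η⌋ with hc
  set D : Finset ℤ := Finset.Icc (1 - (L:ℤ)) ⌊1 / η⌋ with hD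
  set J : Finset ℤ := Finset.Icc (⌊a / η⌋ - (L:ℤ) + 1) ⌊b / η⌋ with hJ
  set h : ℤ → ℝ := fun j => ∑ n ∈ S, win L j (c n) with hh
  set μ : ℝ := L * N * η with hμ
  have hc0 : ∀ n, 0 ≤ c n := fun n => Int.floor_nonneg.2 (div_nonneg (hx n).1 hη.le)
  have hc1 : ∀ n, c n ≤ ⌊1 / η⌋ := fun n =>
    Int.floor_le_floor (div_le_div_of_nonneg_right (hx n).2.le hη.le)
  have hfa : 0 ≤ ⌊a / η⌋ := Int.floor_nonneg.2 (div_nonneg ha hη.le)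
  have hfb : ⌊b / η⌋ ≤ ⌊1 / η⌋ := Int.floor_le_floor (div_le_div_of_nonneg_right hb hη.le)
  have hfab : ⌊a / η⌋ ≤ ⌊b / η⌋ := Int.floor_le_floor (div_le_div_of_nonneg_right hab hη.le)
  have hJD : J ⊆ D := Finset.Icc_subset_Icc (by omega) hfb
  have hDc : (D.card : ℝ) ≤ 1 / η + L := by
    have h0 : (D.card : ℤ) = ⌊1 / η⌋ + L := by
      rw [hD, Int.card_Icc]; omega
    have h1 : (D.card : ℝ) = (⌊1 / η⌋ : ℝ) + L := by exact_mod_cast h0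
    rw [h1]; linarith [Int.floor_le (1 / η)]
  have hJc : (J.card : ℝ) ≤ (b - a) / η + L + 1 := by
    have h0 : (J.card : ℤ) = ⌊b / η⌋ - ⌊a / η⌋ + L := by
      rw [hJ, Int.card_Icc]; omega
    have h1 : (J.card : ℝ) = (⌊b / η⌋ : ℝ) - (⌊a / η⌋ : ℝ) + L := by exact_mod_cast h0
    rw [h1, sub_div]; linarith [Int.floor_le (b / η), Int.lt_floor_add_one (a / η)]
  have hN0 : 0 ≤ N := by rw [hN]; positivity
  have hμ0 : 0 ≤ μ := by positivity
  -- mean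
  have hmean : ∑ j ∈ D, h j = L * N := by
    rw [hh, Finset.sum_comm]
    rw [Finset.sum_congr rfl (fun n _ => win_sum L _ _ (c n) (by linarith [hc0 n]) (hc1 n))]
    simp [hN, mul_comm]
  -- second moment
  have hsq : ∑ j ∈ D, h j ^ 2 ≤ Q := by
    have e1 : ∑ j ∈ D, h j ^ 2 = ∑ m ∈ S, ∑ n ∈ S, ∑ j ∈ D, win L j (c m) * win L j (c n) := by
      have : ∀ j, h j ^ 2 = ∑ m ∈ S, ∑ n ∈ S, win L j (c m) * win L j (c n) := by
        intro j; rw [sq, hh, Finset.sum_mul_sum]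
      simp_rw [this]
      rw [Finset.sum_comm]
      refine Finset.sum_congr rfl fun m _ => ?_
      rw [Finset.sum_comm]
    rw [e1]
    calc _ ≤ ∑ m ∈ S, ∑ n ∈ S, ∑ l ∈ Finset.range L,
            ((if m = n then (1:ℝ) else 0) +
              if (m ≠ n ∧ nint (x m - x n) ≤ ((l:ℝ) + 1) * η) then (1:ℝ) else 0) := by
          refine Finset.sum_le_sum fun m _ => Finset.sum_le_sum fun n _ => ?_
          refine (win_pair L _ _ _ _).trans (Finset.sum_le_sum fun l _ => ?_)
          by_cases hmn : m = n
          · simp [hmn]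
          · by_cases hl : (c m - c n).natAbs ≤ l
            · have : nint (x m - x n) ≤ ((l:ℝ) + 1) * η := by
                refine (nint_le_abs _).trans ?_
                have h1 : |c m - c n| ≤ l := by rw [abs_le]; omega
                have h2 : |(c m : ℝ) - c n| ≤ l := by exact_mod_cast h1
                have h3 : |x m / η - x n / η| ≤ l + 1 := by
                  have := Int.floor_le (x m / η)
                  have := Int.lt_floor_add_one (x m / η)
                  have := Int.floor_le (x n / η)
                  have := Int.lt_floor_add_one (x n / η)
                  rw [abs_le] at h2 ⊢
                  simp only [hc] at h2
                  constructor <;> linarith [h2.1, h2.2]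
                rw [← sub_div, abs_div, abs_of_pos hη, div_le_iff₀ hη] at h3
                exact h3
              simp [hmn, hl, this]
            · rw [if_neg hl]; split_ifs <;> simp
      _ = Q := by
          rw [hQ]
          simp_rw [Finset.sum_add_distrib]
          congr 1
          · simp [hN, mul_comm]
          · have : ∀ l : ℕ, (((S ×ˢ S).filter
              (fun p => p.1 ≠ p.2 ∧ nint (x p.1 - x p.2) ≤ ((l:ℝ) + 1) * η)).card : ℝ)
              = ∑ m ∈ S, ∑ n ∈ S,
                if (m ≠ n ∧ nint (x m - x n) ≤ ((l:ℝ) + 1) * η) then (1:ℝ) else 0 := by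
              intro l
              rw [← Finset.sum_boole, Finset.sum_product]
            simp_rw [this]
            symm
            rw [Finset.sum_comm]
            refine Finset.sum_congr rfl fun m _ => ?_
            rw [Finset.sum_comm]
  have hV : ∑ j ∈ D, (h j - μ) ^ 2 ≤ Q - L ^ 2 * N ^ 2 * η + L ^ 2 * N ^ 2 * η ^ 2 * L := by
    have e : ∑ j ∈ D, (h j - μ) ^ 2 = ∑ j ∈ D, h j ^ 2 - 2 * μ * (L * N) + D.card * μ ^ 2 := by
      rw [← hmean, Finset.mul_sum, ← Finset.sum_sub_distrib, ← nsmul_eq_mul, ← Finset.sum_const,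
        ← Finset.sum_add_distrib]
      exact Finset.sum_congr rfl fun j _ => by ring
    rw [e]
    have h1 : D.card * μ ^ 2 ≤ (1 / η + L) * μ ^ 2 := by gcongr
    have h2 : (1 / η + L) * μ ^ 2 = L ^ 2 * N ^ 2 * η + L ^ 2 * N ^ 2 * η ^ 2 * L := by
      rw [hμ]; field_simp
    have h3 : 2 * μ * (L * N) = 2 * (L ^ 2 * N ^ 2 * η) := by rw [hμ]; ring
    linarith
  have hVJ : ∑ j ∈ J, (h j - μ) ^ 2 ≤ ∑ j ∈ D, (h j - μ) ^ 2 :=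
    Finset.sum_le_sum_of_subset_of_nonneg hJD fun _ _ _ => sq_nonneg _
  have hV0 : 0 ≤ ∑ j ∈ J, (h j - μ) ^ 2 := Finset.sum_nonneg fun _ _ => sq_nonneg _
  have hcs : (∑ j ∈ J, (h j - μ)) ^ 2 ≤ J.card * ∑ j ∈ J, (h j - μ) ^ 2 := sq_sum_le_card_mul_sum_sq
  have hfin : ∑ j ∈ J, (h j - μ)
      ≤ √(((b - a) / η + L + 1) * (Q - L ^ 2 * N ^ 2 * η + L ^ 2 * N ^ 2 * η ^ 2 * L)) := by
    refine Real.le_sqrt_of_sq_le (hcs.trans ?_)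
    exact mul_le_mul hJc (hVJ.trans hV) hV0 (le_trans (by positivity) hJc)
  have hA : ((S.filter (fun n => a ≤ x n ∧ x n < b)).card : ℝ) * L ≤ ∑ j ∈ J, h j := by
    rw [hh, Finset.sum_comm]
    have hw : ∀ j c, 0 ≤ win L j c := by intro j c; unfold win; split_ifs <;> norm_num
    refine le_trans (le_of_eq ?_) (Finset.sum_le_sum_of_subset_of_nonneg
      (Finset.filter_subset (fun n => a ≤ x n ∧ x n < b) S)
      fun n _ _ => Finset.sum_nonneg fun j _ => hw _ _)
    rw [← nsmul_eq_mul, ← Finset.sum_const]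
    refine Finset.sum_congr rfl fun n hn => ?_
    rw [Finset.mem_filter] at hn
    have h1 : ⌊a / η⌋ ≤ c n := Int.floor_le_floor (div_le_div_of_nonneg_right hn.2.1 hη.le)
    have h2 : c n ≤ ⌊b / η⌋ := Int.floor_le_floor (div_le_div_of_nonneg_right hn.2.2.le hη.le)
    exact (win_sum L _ _ _ (by omega) h2).symm
  rw [Finset.sum_sub_distrib, Finset.sum_const, nsmul_eq_mul] at hfin
  have : J.card * μ ≤ μ * ((b - a) / η + L + 1) := by rw [mul_comm]; gcongr
  linarith

lemma upper (α : ℝ) (hα0 : 0 < α) (hα1 : α < 1)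
    (x : ℕ → ℝ) (hx : ∀ n, x n ∈ Set.Ico (0 : ℝ) 1)
    (hwpc : ∀ s : ℝ, 0 < s →
      Tendsto (fun N : ℕ =>
        (((Finset.Icc 1 N ×ˢ Finset.Icc 1 N).filter
          (fun p => p.1 ≠ p.2 ∧ nint (x p.1 - x p.2) ≤ s / (N : ℝ) ^ α)).card : ℝ) /
          (N : ℝ) ^ (2 - α))
        atTop (nhds (2 * s)))
    (a b : ℝ) (ha : 0 ≤ a) (hab : a ≤ b) (hb : b ≤ 1) (ε : ℝ) (hε : 0 < ε) :
    ∀ᶠ N : ℕ in atTop,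
      (((Finset.Icc 1 N).filter (fun n => a ≤ x n ∧ x n < b)).card : ℝ) / N < b - a + ε := by
  obtain ⟨k, hk⟩ := exists_nat_gt (1 / ε ^ 2)
  set L : ℕ := k + 1 with hLdef
  have hLε : 1 / ε ^ 2 < (L : ℝ) := by rw [hLdef]; push_cast; linarith
  have hLpos : (0:ℝ) < L := by rw [hLdef]; positivity
  set P : ℝ → ℕ → ℝ := fun s N => (((Finset.Icc 1 N ×ˢ Finset.Icc 1 N).filter
          (fun p => p.1 ≠ p.2 ∧ nint (x p.1 - x p.2) ≤ s / (N : ℝ) ^ α)).card : ℝ) with hP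
  set η : ℕ → ℝ := fun N => 1 / (L * (N:ℝ) ^ α) with hηd
  set R : ℕ → ℝ := fun N => (N:ℝ) ^ (α - 1) +
    (1 / L) * ∑ l ∈ Finset.range L, P (((l:ℝ) + 1) / L) N / (N:ℝ) ^ (2 - α) with hR
  have hcast : Tendsto (fun N : ℕ => (N:ℝ)) atTop atTop := tendsto_natCast_atTop_atTop
  have tη : Tendsto η atTop (nhds 0) := by
    have := ((tendsto_rpow_atTop hα0).comp hcast).const_mul_atTop hLpos
    refine (tendsto_inv_atTop_zero.comp this).congr fun N => ?_
    simp only [hηd, Function.comp_apply, one_div]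
  have tR : Tendsto R atTop (nhds (1 + 1 / L)) := by
    have t1 : Tendsto (fun N : ℕ => (N:ℝ) ^ (α - 1)) atTop (nhds 0) := by
      have := (tendsto_rpow_neg_atTop (by linarith : 0 < 1 - α)).comp hcast
      simpa [Function.comp_def] using this
    have t2 : Tendsto (fun N : ℕ => ∑ l ∈ Finset.range L,
        P (((l:ℝ) + 1) / L) N / (N:ℝ) ^ (2 - α)) atTop
        (nhds (∑ l ∈ Finset.range L, 2 * (((l:ℝ) + 1) / L))) :=
      tendsto_finsetSum _ fun l _ => hwpc _ (by positivity)
    have e : ∑ l ∈ Finset.range L, 2 * (((l:ℝ) + 1) / L) = L + 1 := by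
      have : ∀ M : ℕ, ∑ l ∈ Finset.range M, 2 * (((l:ℝ) + 1) / L) = M * (M + 1) / L := by
        intro M
        induction M with
        | zero => simp
        | succ M ih => rw [Finset.sum_range_succ, ih]; push_cast; field_simp; ring
      rw [this]; field_simp
    rw [e] at t2
    have := t1.add (t2.const_mul (1 / (L:ℝ)))
    convert this using 2
    field_simp; ring
  have tB : Tendsto (fun N => (b - a) + (L + 1) * η N +
      √(((b - a) + (L + 1) * η N) * (R N - 1 + L * η N))) atTop
      (nhds ((b - a) + (L + 1) * 0 + √(((b - a) + (L + 1) * 0) * ((1 + 1 / L) - 1 + L * 0)))) := by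
    have t3 := (tη.const_mul ((L:ℝ) + 1)).const_add (b - a)
    exact t3.add ((t3.mul ((tR.sub_const 1).add (tη.const_mul (L:ℝ)))).sqrt)
  have hlim : (b - a) + (L + 1) * 0 + √(((b - a) + (L + 1) * 0) * ((1 + 1 / (L:ℝ)) - 1 + L * 0))
      < b - a + ε := by
    have : √(((b - a) + (L + 1) * 0) * ((1 + 1 / (L:ℝ)) - 1 + L * 0)) < ε := by
      rw [Real.sqrt_lt' hε]
      have h1 : 1 / (L:ℝ) < ε ^ 2 := by
        rw [div_lt_iff₀ hLpos]
        rw [div_lt_iff₀ (by positivity)] at hLε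
        linarith
      have h2 : (0:ℝ) < 1 / L := by positivity
      nlinarith
    linarith
  filter_upwards [tB.eventually_lt_const hlim, eventually_ge_atTop 1] with N hN hN1
  refine lt_of_le_of_lt ?_ hN
  have hNpos : (0:ℝ) < N := by exact_mod_cast hN1
  have hpow : (0:ℝ) < (N:ℝ) ^ α := by positivity
  have hη : 0 < η N := by simp only [hηd]; positivity
  have key := core (Finset.Icc 1 N) x hx (η N) hη L (by omega) a b ha hab hb _ (N:ℝ)
    (by simp) rfl
  set Q := ∑ l ∈ Finset.range L, ((N:ℝ) + (((Finset.Icc 1 N ×ˢ Finset.Icc 1 N).filter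
          (fun p => p.1 ≠ p.2 ∧ nint (x p.1 - x p.2) ≤ ((l:ℝ) + 1) * η N)).card : ℝ)) with hQ
  have hQR : Q = L ^ 2 * (N:ℝ) ^ 2 * η N * R N := by
    have e0 : ∀ l : ℕ, ((l:ℝ) + 1) * η N = ((l:ℝ) + 1) / L / (N:ℝ) ^ α := by
      intro l; simp only [hηd]; field_simp
    have e1 : Q = L * N + ∑ l ∈ Finset.range L, P (((l:ℝ) + 1) / L) N := by
      rw [hQ, Finset.sum_add_distrib]
      simp only [e0, hP]
      simp
    have p1 : (N:ℝ) ^ (α - 1) = (N:ℝ) ^ α / N := by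
      rw [Real.rpow_sub hNpos, Real.rpow_one]
    have p2 : (N:ℝ) ^ (2 - α) = (N:ℝ) ^ 2 / (N:ℝ) ^ α := by
      rw [Real.rpow_sub hNpos]; norm_num
    rw [e1]
    simp only [hR, hηd]
    rw [← Finset.sum_div, p1, p2]
    field_simp
  set C : ℝ := L * N with hC
  have hCpos : 0 < C := by positivity
  have hX : ((b - a) / η N + L + 1) * (Q - L ^ 2 * (N:ℝ) ^ 2 * η N
      + L ^ 2 * (N:ℝ) ^ 2 * (η N) ^ 2 * L)
      = C ^ 2 * (((b - a) + (L + 1) * η N) * (R N - 1 + L * η N)) := by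
    rw [hQR, hC]; field_simp; ring
  rw [hX, Real.sqrt_mul (by positivity), Real.sqrt_sq hCpos.le] at key
  have hY : C * η N * ((b - a) / η N + L + 1) = C * ((b - a) + (L + 1) * η N) := by
    field_simp
    ring
  rw [hY, ← mul_add] at key
  rw [div_le_iff₀ hNpos]
  refine le_of_mul_le_mul_right (key.trans (le_of_eq ?_)) hLpos
  rw [hC]; ring

/-- (Nair–Pollicott type) If a sequence in [0,1) has weak pair
correlation with exponent 0 < α < 1, i.e. for every s > 0,
lim_N N^{α-2} #{m ≠ n ≤ N : ‖x_m - x_n‖ ≤ s/N^α} = 2s,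
then it is uniformly distributed in [0,1). -/
theorem stmt7 (α : ℝ) (hα0 : 0 < α) (hα1 : α < 1)
    (x : ℕ → ℝ) (hx : ∀ n, x n ∈ Set.Ico (0 : ℝ) 1)
    (hwpc : ∀ s : ℝ, 0 < s →
      Tendsto (fun N : ℕ =>
        (((Finset.Icc 1 N ×ˢ Finset.Icc 1 N).filter
          (fun p => p.1 ≠ p.2 ∧ nint (x p.1 - x p.2) ≤ s / (N : ℝ) ^ α)).card : ℝ) /
          (N : ℝ) ^ (2 - α))
        atTop (nhds (2 * s)))
    (a b : ℝ) (ha : 0 ≤ a) (hab : a < b) (hb : b ≤ 1) :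
    Tendsto (fun N : ℕ =>
      (((Finset.Icc 1 N).filter (fun n => a ≤ x n ∧ x n < b)).card : ℝ) / N)
      atTop (nhds (b - a)) := by
  rw [Metric.tendsto_atTop']
  intro ε hε
  have u1 := upper α hα0 hα1 x hx hwpc a b ha hab.le hb ε hε
  have u2 := upper α hα0 hα1 x hx hwpc 0 a le_rfl ha (by linarith) (ε / 2) (by linarith)
  have u3 := upper α hα0 hα1 x hx hwpc b 1 (by linarith) hb le_rfl (ε / 2) (by linarith)
  have := (u1.and (u2.and u3)).and (eventually_ge_atTop 1)
  obtain ⟨M, hM⟩ := eventually_atTop.1 this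
  refine ⟨M, fun N hN => ?_⟩
  obtain ⟨⟨h1, h2, h3⟩, h4⟩ := hM N hN.le
  have hNpos : (0:ℝ) < N := by exact_mod_cast h4
  set A := (Finset.Icc 1 N).filter (fun n => a ≤ x n ∧ x n < b)
  set B := (Finset.Icc 1 N).filter (fun n => 0 ≤ x n ∧ x n < a)
  set C := (Finset.Icc 1 N).filter (fun n => b ≤ x n ∧ x n < 1)
  have hsub : Finset.Icc 1 N ⊆ A ∪ (B ∪ C) := by
    intro n hn
    simp only [A, B, C, Finset.mem_union, Finset.mem_filter, hn, true_and]
    have := (hx n).1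
    have := (hx n).2
    by_cases q1 : x n < a
    · tauto
    · by_cases q2 : x n < b
      · left; exact ⟨not_lt.1 q1, q2⟩
      · right; right; exact ⟨not_lt.1 q2, (hx n).2⟩
  have hcard : N ≤ A.card + (B.card + C.card) := by
    have e1 := Finset.card_le_card hsub
    have e2 := Finset.card_union_le A (B ∪ C)
    have e3 := Finset.card_union_le B C
    simp only [Nat.card_Icc] at e1
    omega
  have hcard' : (N:ℝ) ≤ A.card + (B.card + C.card) := by exact_mod_cast hcard
  have hone : 1 ≤ (A.card : ℝ) / N + (B.card / N + C.card / N) := by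
    rw [← add_div, ← add_div, le_div_iff₀ hNpos]; linarith
  rw [Real.dist_eq, abs_lt]
  constructor <;> linarith
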